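/- Fix a finite set $\mathcal S=\mathcal S_v\uplus\mathcal S_{id}$ of types (primitive types and id types), each with a domain that contains a constant $\mathtt{undef}$. A relation schema $R$ is a name with a nonempty tuple of distinct attributes, each having a type in $\mathcal S$; its first attribute is denoted $R.id$. A catalog $Cat$ is a finite set of relation schemas with distinct names such that (1) the type of $R.id$ is an id type for every $R\in Cat$, and $R.id$ is called the primary key of $R$; (2) distinct $R_1,R_2\in Cat$ have primary keys of different types; (3) whenever an attribute $a\neq R.id$ of some $R\in Cat$ has an id type $S$, there is $R_2\in Cat$ whose primary key has type $S$, and $a$ is then called a foreign key referring to $R_2$. A DAB (data-aware BPMN process) is a pair of a data schema and a process block over it, where a data schema consists of a catalog, a case identifier type, a repository of updatable relation schemas and a finite set of case variables. The characteristic graph $G(Cat)$ is the directed graph whose nodes are the pairs $\langle R,a\rangle$ with $R\in Cat$ and $a$ an attribute of $R$, with an edge $\langle R_1,a_1\rangle\to\langle R_2,a_2\rangle$ iff either $R_1=R_2$, $a_2\neq a_1$ and $a_1=R_1.id$, or $a_2=R_2.id$ and $a_1$ is a foreign key referring to $R_2$. A DAB is acyclic if $G(Cat)$ has no directed cycle,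 where $Cat$ is its catalog. A DB signature is a finite multi-sorted signature $\Sigma$ whose only symbols are equality, unary functions and constants; its characteristic graph $G(\Sigma)$ has the sorts of $\Sigma$ as nodes and an edge $S\to S'$ for each function symbol $f:S\to S'$ of $\Sigma$, and $\Sigma$ is acyclic if $G(\Sigma)$ has no directed cycle (loops count as cycles). The DB schema $\langle\Sigma,T\rangle$ of the relational artifact system obtained by translating a DAB with catalog $Cat$ has as sorts the types in $\mathcal S$, as function symbols one $f_{R,a}:S_{R.id}\to S_a$ for each $R\in Cat$ and each attribute $a\neq R.id$ of $R$ (where $S_a$ denotes the type of $a$), and a constant $\mathtt{undef}$ of each sort; its theory $T$ consists of the sentences $\forall x\,(x=\mathtt{undef}\leftrightarrow f(x)=\mathtt{undef})$ for all function symbols $f$. Then a DAB is acyclic if and only if the DB schema of the relational artifact system obtained from it by the translation has an acyclic signature $\Sigma$. -/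

import Mathlib

universe u

namespace DABModel

/-! ### Types, relation schemas, catalogs -/

/-- The semantic types: primitive types and id types, each with a domain containing a
distinguished undefined value. There are finitely many of them, since they are the sorts of the
(finite) signature into which data-aware processes are translated. -/
structure TypeSystem where
  Prim : Type u
  Id : Type u
  finitePrim : Finite Prim
  finiteId : Finite Id
  Dom : Prim ⊕ Id → Type u
  undef : ∀ S, Dom S

/-- The set of all types, the disjoint union of primitive and id types. -/
abbrev TypeSystem.Ty (𝒯 : TypeSystem.{u}) : Type u := 𝒯.Prim ⊕ 𝒯.Id

instance (𝒯 : TypeSystem.{u}) : Finite 𝒯.Ty :=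
  haveI := 𝒯.finitePrim
  haveI := 𝒯.finiteId
  inferInstanceAs (Finite (𝒯.Prim ⊕ 𝒯.Id))

/-- A relation schema: a name and a nonempty tuple of typed attributes with distinct names.
As the names are distinct, an attribute is identified with its position in the tuple. -/
structure RelSchema (𝒯 : TypeSystem.{u}) where
  name : String
  /-- The number of attributes after the first one. -/
  n : ℕ
  attrName : Fin (n + 1) → String
  attrName_injective : Function.Injective attrName
  attrType : Fin (n + 1) → 𝒯.Ty

/-- The attributes of a relation schema. -/
abbrev RelSchema.Attr {𝒯 : TypeSystem.{u}} (R : RelSchema 𝒯) : Type := Fin (R.n + 1)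

/-- The first attribute of a relation schema; in a catalog it is the primary key `R.id`. -/
def RelSchema.key {𝒯 : TypeSystem.{u}} (R : RelSchema 𝒯) : R.Attr := 0

/-- A catalog: a finite set of relation schemas (with distinct names) with single-column primary
keys of pairwise different id types, such that every other attribute of id type has the type of
the primary key of some relation of the catalog. -/
structure Catalog (𝒯 : TypeSystem.{u}) where
  rels : Finset (RelSchema 𝒯)
  names_distinct : ∀ R₁ ∈ rels, ∀ R₂ ∈ rels, R₁.name = R₂.name → R₁ = R₂
  single_column_primary_key : ∀ R ∈ rels, ∃ S : 𝒯.Id, R.attrType R.key = Sum.inr S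
  nonambiguous_primary_keys : ∀ R₁ ∈ rels, ∀ R₂ ∈ rels, R₁ ≠ R₂ →
    R₁.attrType R₁.key ≠ R₂.attrType R₂.key
  foreign_keys : ∀ R ∈ rels, ∀ a : R.Attr, a ≠ R.key → ∀ S : 𝒯.Id, R.attrType a = Sum.inr S →
    ∃ R₂ ∈ rels, R₂.attrType R₂.key = Sum.inr S

/-- The relations of a catalog. -/
abbrev Catalog.Rel {𝒯 : TypeSystem.{u}} (Cat : Catalog 𝒯) : Type u := {R // R ∈ Cat.rels}

/-- The attribute `a` of `R` is a foreign key referring to `R₂`: it is a non-id attribute, its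
type is an id type, and this type is the type of the primary key of `R₂`. -/
def IsForeignKey {𝒯 : TypeSystem.{u}} (R : RelSchema 𝒯) (a : R.Attr) (R₂ : RelSchema 𝒯) : Prop :=
  a ≠ R.key ∧ ∃ S : 𝒯.Id, R.attrType a = Sum.inr S ∧ R₂.attrType R₂.key = Sum.inr S

/-- A directed graph is acyclic if no node lies on a directed cycle, i.e. no node is reached from
itself by a directed walk of positive length (loops are cycles). -/
def IsAcyclicDigraph {V : Type u} (G : Digraph V) : Prop :=
  ∀ v : V, ¬ Relation.TransGen G.Adj v v

/-- The characteristic graph of a catalog. Its nodes are the pairs `⟨R, a⟩` of a relation `R` of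
the catalog and an attribute `a` of `R`. -/
def Catalog.charGraph {𝒯 : TypeSystem.{u}} (Cat : Catalog 𝒯) :
    Digraph (Σ R : Cat.Rel, R.1.Attr) where
  Adj p q :=
    (p.1 = q.1 ∧ q ≠ p ∧ p.2 = p.1.1.key) ∨
    (q.2 = q.1.1.key ∧ IsForeignKey p.1.1 p.2 q.1.1)

/-! ### Data schemas -/

/-- Typed variables; there are countably many of every type. -/
abbrev Var (𝒯 : TypeSystem.{u}) : Type u := Σ _ : 𝒯.Ty, String

/-- A data schema: a catalog, a case identifier type, a repository and a finite set of case
variables, among them `self`. -/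
structure DataSchema (𝒯 : TypeSystem.{u}) where
  cat : Catalog 𝒯
  ctype : 𝒯.Id
  repo : Finset (RelSchema 𝒯)
  cvars : Finset (Var 𝒯)
  self : Var 𝒯
  names_distinct : ∀ R₁ R₂ : RelSchema 𝒯, (R₁ ∈ cat.rels ∨ R₁ ∈ repo) →
    (R₂ ∈ cat.rels ∨ R₂ ∈ repo) → R₁.name = R₂.name → R₁ = R₂
  ctype_fresh : ∀ R ∈ cat.rels, ∀ a : R.Attr, R.attrType a ≠ Sum.inr ctype
  repo_ids : ∀ R ∈ repo, ∀ a : R.Attr, ∀ S : 𝒯.Id, R.attrType a = Sum.inr S →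
    S = ctype ∨ ∃ R₂ ∈ cat.rels, R₂.attrType R₂.key = Sum.inr S
  cvars_ids : ∀ x ∈ cvars, ∀ S : 𝒯.Id, x.1 = Sum.inr S →
    S = ctype ∨ ∃ R₂ ∈ cat.rels, R₂.attrType R₂.key = Sum.inr S
  self_mem : self ∈ cvars
  self_type : self.1 = Sum.inr ctype

/-! ### Conditions, queries and updates over a data schema (all well-typed by construction) -/

/-- Arguments of queries: typed variables or constant objects. -/
inductive Arg (𝒯 : TypeSystem.{u}) : 𝒯.Ty → Type u
  | var (x : Var 𝒯) : Arg 𝒯 x.1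
  | obj {S : 𝒯.Ty} (d : 𝒯.Dom S) : Arg 𝒯 S

/-- The variables of an argument. -/
def Arg.vars {𝒯 : TypeSystem.{u}} {S : 𝒯.Ty} : Arg 𝒯 S → Set (Var 𝒯)
  | .var x => {x}
  | .obj _ => ∅

/-- Boolean conditions over variables and constant objects. -/
inductive Condition (𝒯 : TypeSystem.{u}) : Type u
  | eq {S : 𝒯.Ty} (s t : Arg 𝒯 S) : Condition 𝒯
  | not (φ : Condition 𝒯) : Condition 𝒯
  | and (φ ψ : Condition 𝒯) : Condition 𝒯

/-- A condition is cubical if negation occurs only in front of atoms. -/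
inductive Condition.IsCubical {𝒯 : TypeSystem.{u}} : Condition 𝒯 → Prop
  | eq {S : 𝒯.Ty} (s t : Arg 𝒯 S) : IsCubical (.eq s t)
  | not_eq {S : 𝒯.Ty} (s t : Arg 𝒯 S) : IsCubical (.not (.eq s t))
  | and {φ ψ : Condition 𝒯} : IsCubical φ → IsCubical ψ → IsCubical (.and φ ψ)

/-- The variables occurring in a condition. -/
def Condition.vars {𝒯 : TypeSystem.{u}} : Condition 𝒯 → Set (Var 𝒯)
  | .eq s t => s.vars ∪ t.vars
  | .not φ => φ.vars
  | .and φ ψ => φ.vars ∪ ψ.vars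

/-- Conjunctive queries with filters over a data schema. -/
inductive Query {𝒯 : TypeSystem.{u}} (D : DataSchema 𝒯) : Type u
  | cond (φ : Condition 𝒯) (h : φ.IsCubical) : Query D
  | rel (R : RelSchema 𝒯) (h : R ∈ D.cat.rels ∨ R ∈ D.repo)
      (args : ∀ a : R.Attr, Arg 𝒯 (R.attrType a)) : Query D
  | notRel (R : RelSchema 𝒯) (h : R ∈ D.cat.rels ∨ R ∈ D.repo)
      (args : ∀ a : R.Attr, Arg 𝒯 (R.attrType a)) : Query D
  | and (Q₁ Q₂ : Query D) : Query D

/-- The variables occurring in a query. -/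
def Query.vars {𝒯 : TypeSystem.{u}} {D : DataSchema 𝒯} : Query D → Set (Var 𝒯)
  | .cond φ _ => φ.vars
  | .rel _ _ args => ⋃ a, (args a).vars
  | .notRel _ _ args => ⋃ a, (args a).vars
  | .and Q₁ Q₂ => Q₁.vars ∪ Q₂.vars

/-- The free variables of a query: those that are not case variables. -/
def Query.free {𝒯 : TypeSystem.{u}} {D : DataSchema 𝒯} (Q : Query D) : Set (Var 𝒯) :=
  Q.vars \ {x | x ∈ D.cvars}

/-- A query is repo-free if none of its atoms queries the repository. -/
def Query.RepoFree {𝒯 : TypeSystem.{u}} {D : DataSchema 𝒯} : Query D → Prop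
  | .cond _ _ => True
  | .rel R _ _ => R ∉ D.repo
  | .notRel R _ _ => R ∉ D.repo
  | .and Q₁ Q₂ => Q₁.RepoFree ∧ Q₂.RepoFree

/-- Guards: unions of conjunctive queries with filters, with answer variables. -/
structure Guard {𝒯 : TypeSystem.{u}} (D : DataSchema 𝒯) where
  answer : List (Var 𝒯)
  disjuncts : List (Query D)
  answer_free : ∀ Q ∈ disjuncts, ∀ x ∈ answer, x ∈ Q.free

/-- A guard is repo-free if all its disjuncts are. -/
def Guard.RepoFree {𝒯 : TypeSystem.{u}} {D : DataSchema 𝒯} (G : Guard D) : Prop :=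
  ∀ Q ∈ G.disjuncts, Q.RepoFree

/-- Arguments that may occur in the effect of an update with precondition `G`: constant objects,
answer variables of `G`, and case variables. -/
abbrev EffArg {𝒯 : TypeSystem.{u}} {D : DataSchema 𝒯} (G : Guard D) (S : 𝒯.Ty) : Type u :=
  {t : Arg 𝒯 S // ∀ x ∈ t.vars, x ∈ G.answer ∨ x ∈ D.cvars}

/-- The `SET` part of an effect: a simultaneous assignment to distinct case variables different
from `self` (`none` means that the variable is not mentioned). -/
abbrev SetPart {𝒯 : TypeSystem.{u}} {D : DataSchema 𝒯} (G : Guard D) : Type u :=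
  ∀ x : Var 𝒯, x ∈ D.cvars → x ≠ D.self → Option (EffArg G x.1)

/-- A tuple of effect arguments matching the attributes of `R`. -/
abbrev EffTuple {𝒯 : TypeSystem.{u}} {D : DataSchema 𝒯} (G : Guard D) (R : RelSchema 𝒯) :
    Type u :=
  ∀ a : R.Attr, EffArg G (R.attrType a)

/-- The (possibly nested) `IF ... THEN ... ELSE ...` part of a conditional update of `R(v)` with
precondition `G`; the leaves may also use the new variables `v`. -/
inductive Branch {𝒯 : TypeSystem.{u}} {D : DataSchema 𝒯} (G : Guard D) (R : RelSchema 𝒯)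
    (v : R.Attr → Var 𝒯) : Type u
  | leaf (args : ∀ a : R.Attr, Arg 𝒯 (R.attrType a))
      (h : ∀ a, ∀ x ∈ (args a).vars, x ∈ G.answer ∨ x ∈ D.cvars ∨ x ∈ Set.range v) :
      Branch G R v
  | ite (filter : Guard D) (h : filter.RepoFree) (thenB elseB : Branch G R v) : Branch G R v

/-- Effect rules of an update with precondition `G`. -/
inductive Effect {𝒯 : TypeSystem.{u}} {D : DataSchema 𝒯} (G : Guard D) : Type u
  | set (s : SetPart G) : Effect G
  | insertSet (R : RelSchema 𝒯) (h : R ∈ D.repo) (t : EffTuple G R) (s : SetPart G) : Effect G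
  | deleteSet (R : RelSchema 𝒯) (h : R ∈ D.repo) (t : EffTuple G R) (s : SetPart G) : Effect G
  | condUpdate (R : RelSchema 𝒯) (h : R ∈ D.repo) (v : R.Attr → Var 𝒯)
      (v_type : ∀ a, (v a).1 = R.attrType a) (v_injective : Function.Injective v)
      (v_new : ∀ a, v a ∉ G.answer ∧ v a ∉ D.cvars)
      (filter : Guard D) (filter_repoFree : filter.RepoFree) (thenB elseB : Branch G R v) :
      Effect G

/-- An effect rule that changes case variables only. -/
inductive Effect.OnlyCaseVars {𝒯 : TypeSystem.{u}} {D : DataSchema 𝒯} {G : Guard D} :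
    Effect G → Prop
  | set (s : SetPart G) : OnlyCaseVars (.set s)

/-- Update specifications. -/
structure UpdateSpec {𝒯 : TypeSystem.{u}} (D : DataSchema 𝒯) where
  pre : Guard D
  eff : Effect pre

/-! ### Process blocks and data-aware BPMN processes -/

inductive CatchType | msg | timer | none
inductive EndType | msg | none
inductive CompletionType | error | msg | none
inductive BoundaryType | error | msg | timer
inductive NonInterruptingType | msg | timer
/-- Deferred choice or parallel gateway. -/
inductive ForkGateway | deferredChoice | parallel
/-- Exclusive or inclusive choice gateway. -/
inductive ChoiceGateway | exclusive | inclusive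

/-- The kinds of blocks that are singled out as components of other blocks. -/
inductive BlockKind | process | subprocess | catchEvent | other

/-- Block-structured processes whose conditions and updates are expressed over `D`. -/
inductive Block {𝒯 : TypeSystem.{u}} (D : DataSchema 𝒯) : BlockKind → Type u
  | empty : Block D .other
  | atomicTask (α : UpdateSpec D) : Block D .other
  | nonatomicTask (α : UpdateSpec D) (h : α.eff.OnlyCaseVars) : Block D .other
  | catchEvent (e : CatchType) (α : UpdateSpec D) : Block D .catchEvent
  | process (eₛ : CatchType) (αₛ : UpdateSpec D) (eₜ : EndType) (αₜ : UpdateSpec D)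
      {k : BlockKind} (B : Block D k) : Block D .process
  | subprocess (P : Block D .process) : Block D .subprocess
  | sequence {k₁ k₂ : BlockKind} (B₁ : Block D k₁) (B₂ : Block D k₂) : Block D .other
  | possibleCompletion (φ₁ φ₂ : Condition 𝒯) (e : CompletionType) : Block D .other
  | fork (g : ForkGateway) {k₁ k₂ : BlockKind} (B₁ : Block D k₁) (B₂ : Block D k₂) :
      Block D .other
  | choice (g : ChoiceGateway) (φ₁ φ₂ : Condition 𝒯) {k₁ k₂ : BlockKind} (B₁ : Block D k₁)
      (B₂ : Block D k₂) : Block D .other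
  | loop (φ₁ φ₂ : Condition 𝒯) {k₁ k₂ : BlockKind} (B₁ : Block D k₁) (B₂ : Block D k₂) :
      Block D .other
  | eventChoice (E₁ E₂ : Block D .catchEvent) {k₁ k₂ : BlockKind} (B₁ : Block D k₁)
      (B₂ : Block D k₂) : Block D .other
  | backwardException (e : BoundaryType) (A : Block D .subprocess) {k : BlockKind}
      (B : Block D k) : Block D .other
  | forwardException (e : BoundaryType) (A : Block D .subprocess) {k₁ k₂ : BlockKind}
      (B₁ : Block D k₁) (B₂ : Block D k₂) : Block D .other
  | nonInterruptingException (e : NonInterruptingType) (A : Block D .subprocess)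
      {k₁ k₂ : BlockKind} (B₁ : Block D k₁) (B₂ : Block D k₂) : Block D .other

/-- A data-aware BPMN process: a data schema and a root process block over it. -/
structure DAB (𝒯 : TypeSystem.{u}) where
  data : DataSchema 𝒯
  root : Block data .process

/-- A DAB is acyclic if the characteristic graph of its catalog is acyclic. -/
def DAB.IsAcyclic {𝒯 : TypeSystem.{u}} (M : DAB 𝒯) : Prop :=
  IsAcyclicDigraph M.data.cat.charGraph

/-! ### DB schemas -/

/-- A DB signature: a finite multi-sorted signature whose only symbols are equality, unary
functions and constants. -/
structure DBSignature where
  Srt : Type u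
  Fn : Type u
  Cst : Type u
  finiteSrt : Finite Srt
  finiteFn : Finite Fn
  finiteCst : Finite Cst
  src : Fn → Srt
  tgt : Fn → Srt
  cstSort : Cst → Srt

/-- The characteristic graph of a DB signature: its nodes are the sorts, and there is an edge
`S → S'` for each function symbol `f : S → S'`. (Labels and multiplicities of edges play no role
for acyclicity.) -/
def DBSignature.charGraph (sig : DBSignature.{u}) : Digraph sig.Srt where
  Adj S S' := ∃ f : sig.Fn, sig.src f = S ∧ sig.tgt f = S'

/-- A DB signature is acyclic if its characteristic graph is. -/
def DBSignature.IsAcyclic (sig : DBSignature.{u}) : Prop :=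
  IsAcyclicDigraph sig.charGraph

/-- Well-sorted terms in the variables `x₀ : Γ 0, …, xₙ₋₁ : Γ (n - 1)`. -/
inductive DBSignature.Term (sig : DBSignature.{u}) {n : ℕ} (Γ : Fin n → sig.Srt) :
    sig.Srt → Type u
  | var (i : Fin n) : Term sig Γ (Γ i)
  | cst (c : sig.Cst) : Term sig Γ (sig.cstSort c)
  | app (f : sig.Fn) (t : Term sig Γ (sig.src f)) : Term sig Γ (sig.tgt f)

/-- Quantifier-free formulae. -/
inductive DBSignature.QFFormula (sig : DBSignature.{u}) {n : ℕ} (Γ : Fin n → sig.Srt) : Type u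
  | eq {S : sig.Srt} (s t : sig.Term Γ S) : QFFormula sig Γ
  | not (φ : QFFormula sig Γ) : QFFormula sig Γ
  | and (φ ψ : QFFormula sig Γ) : QFFormula sig Γ
  | iff (φ ψ : QFFormula sig Γ) : QFFormula sig Γ

/-- Universal sentences: universal closures of quantifier-free formulae. -/
structure DBSignature.UniversalSentence (sig : DBSignature.{u}) where
  n : ℕ
  Γ : Fin n → sig.Srt
  body : sig.QFFormula Γ

/-- A DB schema: a DB signature and a DB theory, i.e. a set of universal sentences. -/
structure DBSchema where
  sig : DBSignature.{u}
  theory : Set sig.UniversalSentence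

/-! ### The translation of the catalog -/

/-- The DB signature of a catalog: the sorts are the types; for every relation `R` and every
attribute `a` of `R` other than the primary key there is a function symbol `f_{R,a}` from the type
of the primary key of `R` to the type of `a`; and there is a constant `undef` of every sort. -/
def Catalog.toDBSignature {𝒯 : TypeSystem.{u}} (Cat : Catalog 𝒯) : DBSignature.{u} where
  Srt := 𝒯.Ty
  Fn := Σ R : Cat.Rel, {a : R.1.Attr // a ≠ R.1.key}
  Cst := 𝒯.Ty
  finiteSrt := inferInstance
  finiteFn := inferInstance
  finiteCst := inferInstance
  src f := f.1.1.attrType f.1.1.key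
  tgt f := f.1.1.attrType f.2.1
  cstSort S := S

/-- The constant `undef` of sort `S`, as a term. -/
def Catalog.undefTerm {𝒯 : TypeSystem.{u}} (Cat : Catalog 𝒯) {n : ℕ}
    (Γ : Fin n → Cat.toDBSignature.Srt) (S : Cat.toDBSignature.Srt) :
    Cat.toDBSignature.Term Γ S :=
  DBSignature.Term.cst (sig := Cat.toDBSignature) S

/-- The sentence `∀ x, (x = undef ↔ f(x) = undef)`. -/
def Catalog.undefAxiom {𝒯 : TypeSystem.{u}} (Cat : Catalog 𝒯) (f : Cat.toDBSignature.Fn) :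
    Cat.toDBSignature.UniversalSentence where
  n := 1
  Γ := fun _ => Cat.toDBSignature.src f
  body := .iff
    (.eq (.var 0) (Cat.undefTerm _ (Cat.toDBSignature.src f)))
    (.eq (.app f (.var 0)) (Cat.undefTerm _ (Cat.toDBSignature.tgt f)))

/-- The DB schema of a catalog. -/
def Catalog.toDBSchema {𝒯 : TypeSystem.{u}} (Cat : Catalog 𝒯) : DBSchema.{u} where
  sig := Cat.toDBSignature
  theory := Set.range Cat.undefAxiom

/-- The DB schema (the read-only component) of the relational artifact system into which a DAB is
translated. Case variables, repository and process only contribute to the working memory and the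
transitions of that system: they add artifact sorts, arrays and formulae, but no symbols to the
DB signature relating its sorts. -/
def DAB.translatedDBSchema {𝒯 : TypeSystem.{u}} (M : DAB 𝒯) : DBSchema.{u} :=
  M.data.cat.toDBSchema

end DABModel

namespace DABModel

variable {𝒯 : TypeSystem.{u}}

/-- The edge of the characteristic graph from the primary key of `R` to another attribute. -/
theorem Catalog.charGraph_adj_key (Cat : Catalog 𝒯) (R : Cat.Rel) {a : R.1.Attr}
    (ha : a ≠ R.1.key) : Cat.charGraph.Adj ⟨R, R.1.key⟩ ⟨R, a⟩ := by
  refine Or.inl ⟨rfl, fun h => ha ?_, rfl⟩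
  simpa using h

/-- A non-key attribute having the type of the primary key of `R₂` is a foreign key to `R₂`. -/
theorem Catalog.charGraph_adj_of_attrType_eq (Cat : Catalog 𝒯) (R R₂ : Cat.Rel) {a : R.1.Attr}
    (ha : a ≠ R.1.key) (h : R₂.1.attrType R₂.1.key = R.1.attrType a) :
    Cat.charGraph.Adj ⟨R, a⟩ ⟨R₂, R₂.1.key⟩ := by
  obtain ⟨S, hS⟩ := Cat.single_column_primary_key R₂.1 R₂.2
  exact Or.inr ⟨rfl, ha, S, h ▸ hS, hS⟩

/-- A walk of positive length in the characteristic graph of a catalog either induces one in the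
characteristic graph of its signature or is a single foreign key edge. -/
theorem Catalog.transGen_toDBSignature (Cat : Catalog 𝒯) {p q : Σ R : Cat.Rel, R.1.Attr}
    (h : Relation.TransGen Cat.charGraph.Adj p q) :
    Relation.TransGen Cat.toDBSignature.charGraph.Adj
        (p.1.1.attrType p.2) (q.1.1.attrType q.2) ∨
      (p.2 ≠ p.1.1.key ∧ q.2 = q.1.1.key ∧ p.1.1.attrType p.2 = q.1.1.attrType q.2) := by
  have edge : ∀ {p q : Σ R : Cat.Rel, R.1.Attr}, Cat.charGraph.Adj p q →
      Cat.toDBSignature.charGraph.Adj (p.1.1.attrType p.2) (q.1.1.attrType q.2) ∨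
      (p.2 ≠ p.1.1.key ∧ q.2 = q.1.1.key ∧ p.1.1.attrType p.2 = q.1.1.attrType q.2) := by
    rintro ⟨R, a⟩ ⟨R', b⟩ (⟨hR, hne, hkey⟩ | ⟨hkey, ha, S, hS, hS'⟩)
    · dsimp only at hR hkey
      subst hR hkey
      exact Or.inl ⟨⟨R, b, fun hb => hne (by rw [hb])⟩, rfl, rfl⟩
    · dsimp only at hkey ha hS hS'
      subst hkey
      exact Or.inr ⟨ha, rfl, hS.trans hS'.symm⟩
  induction h with
  | single h => exact (edge h).imp_left .single
  | tail _ h ih =>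
    rcases edge h with h | ⟨hne, -, htype⟩
    · rcases ih with ih | ⟨-, -, htype⟩
      · exact Or.inl (ih.tail h)
      · exact Or.inl (htype ▸ .single h)
    · rcases ih with ih | ⟨-, hkey, -⟩
      · exact Or.inl (htype ▸ ih)
      · exact absurd hkey hne

/-- A walk of positive length between sorts lifts to a walk from a primary key to a non-key
attribute in the characteristic graph of the catalog. -/
theorem Catalog.exists_transGen_charGraph (Cat : Catalog 𝒯) {S T : Cat.toDBSignature.Srt}
    (h : Relation.TransGen Cat.toDBSignature.charGraph.Adj S T) :
    ∃ (R R' : Cat.Rel) (a : R'.1.Attr), a ≠ R'.1.key ∧ R.1.attrType R.1.key = S ∧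
      R'.1.attrType a = T ∧ Relation.TransGen Cat.charGraph.Adj ⟨R, R.1.key⟩ ⟨R', a⟩ := by
  induction h with
  | single h =>
    obtain ⟨⟨R, a, ha⟩, hsrc, htgt⟩ := h
    exact ⟨R, R, a, ha, hsrc, htgt, .single (Cat.charGraph_adj_key R ha)⟩
  | tail _ h ih =>
    obtain ⟨R, R', a, ha, hS, hT, hwalk⟩ := ih
    obtain ⟨⟨R₂, b, hb⟩, hsrc, htgt⟩ := h
    exact ⟨R, R₂, b, hb, hS, htgt,
      (hwalk.tail (Cat.charGraph_adj_of_attrType_eq R' R₂ ha (hsrc.trans hT.symm))).tail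
        (Cat.charGraph_adj_key R₂ hb)⟩

/-- The characteristic graph of a catalog is acyclic iff the signature of the catalog is. -/
theorem Catalog.isAcyclicDigraph_charGraph_iff (Cat : Catalog 𝒯) :
    IsAcyclicDigraph Cat.charGraph ↔ Cat.toDBSignature.IsAcyclic := by
  constructor
  · intro hac S hcycle
    obtain ⟨R, R', a, ha, hS, hT, hwalk⟩ := Cat.exists_transGen_charGraph hcycle
    exact hac _ (hwalk.tail (Cat.charGraph_adj_of_attrType_eq R' R ha (hS.trans hT.symm)))
  · intro hac p hcycle
    rcases Cat.transGen_toDBSignature hcycle with h | ⟨hne, hkey, -⟩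
    · exact hac _ h
    · exact hne hkey

end DABModel

theorem dab_acyclic_iff_translated_signature_acyclic (𝒯 : DABModel.TypeSystem.{u})
    (M : DABModel.DAB 𝒯) :
    M.IsAcyclic ↔ M.translatedDBSchema.sig.IsAcyclic :=
  M.data.cat.isAcyclicDigraph_charGraph_iff
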